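/- (Deutsch's self-consistency condition has a solution.) Let n be a nonempty finite type with decidable equality, let U be a unitary complex matrix indexed by (n × n) × (n × n) (i.e. U ∈ Matrix.unitaryGroup (n × n) ℂ), and let ψ : n → ℂ be a unit vector (Σ_i |ψ_i|² = 1). Let P = vecMulVec ψ (star ψ) be the rank-one projection |ψ⟩⟨ψ|. Then there exists a matrix ρ : Matrix n n ℂ, positive semidefinite with trace ρ = 1, satisfying the consistency condition Tr₂[U (P ⊗ₖ ρ) U*] = ρ; explicitly, for all i, i' ∈ n: Σ_j (U * (P ⊗ₖ ρ) * Uᴴ) ((i,j),(i',j)) = ρ i i', where ⊗ₖ is the Kronecker product of matrices. -/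

import Mathlib

open scoped ComplexOrder Kronecker Matrix

/-- A continuous linear map sending a nonempty compact convex set into itself has a fixed point
in that set. -/
theorem ContinuousLinearMap.exists_fixedPoint_of_isCompact_convex
    {E : Type*} [NormedAddCommGroup E] [NormedSpace ℝ E] (T : E →L[ℝ] E) {K : Set E}
    (hK : IsCompact K) (hconv : Convex ℝ K) (hne : K.Nonempty) (hT : Set.MapsTo T K K) :
    ∃ x ∈ K, T x = x := by
  obtain ⟨x₀, hx₀⟩ := hne
  have horbit (k : ℕ) : T^[k] x₀ ∈ K := hT.iterate k hx₀
  have hmem (N : ℕ) : birkhoffAverage ℝ T id (N + 1) x₀ ∈ K := by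
    rw [birkhoffAverage, birkhoffSum, Finset.smul_sum]
    refine hconv.sum_mem (fun _ _ => by positivity) ?_ (fun k _ => horbit k)
    rw [Finset.sum_const, Finset.card_range, nsmul_eq_mul]
    exact mul_inv_cancel₀ (by positivity)
  have hcomm (N : ℕ) : birkhoffAverage ℝ T id N (T x₀) = T (birkhoffAverage ℝ T id N x₀) := by
    simp only [birkhoffAverage, birkhoffSum, map_smul, map_sum, id, ← Function.iterate_succ_apply,
      Function.iterate_succ_apply']
  have hbdd : Bornology.IsBounded (Set.range fun k : ℕ => id (T^[k] x₀)) :=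
    hK.isBounded.subset (Set.range_subset_iff.2 horbit)
  have hlim := (tendsto_birkhoffAverage_apply_sub_birkhoffAverage ℝ hbdd).comp
    (Filter.tendsto_add_atTop_nat 1)
  obtain ⟨x, hx, φ, hφ, hφx⟩ := hK.tendsto_subseq hmem
  refine ⟨x, hx, sub_eq_zero.1 (tendsto_nhds_unique ?_ (hlim.comp hφ.tendsto_atTop))⟩
  refine (((T.continuous.tendsto x).comp hφx).sub hφx).congr fun N => ?_
  simp [hcomm]

namespace Matrix

section DensityMatrices

variable {m n : Type*} [Fintype m] [Fintype n]

theorem convex_setOf_posSemidef_trace_eq_one :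
    Convex ℝ {ρ : Matrix n n ℂ | ρ.PosSemidef ∧ ρ.trace = 1} := by
  rintro ρ ⟨hρ, hρt⟩ σ ⟨hσ, hσt⟩ a b ha hb hab
  refine ⟨(hρ.smul ha).add (hσ.smul hb), ?_⟩
  rw [trace_add, trace_smul, trace_smul, hρt, hσt, ← add_smul, hab, one_smul]

attribute [local instance] Matrix.frobeniusNormedAddCommGroup Matrix.frobeniusNormedSpace

theorem trace_conjTranspose_mul_self_eq_frobenius_norm_sq (B : Matrix m n ℂ) :
    (Bᴴ * B).trace = ((‖B‖ ^ 2 : ℝ) : ℂ) := by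
  have h : ‖B‖ ^ 2 = ∑ i, ∑ j, ‖B i j‖ ^ 2 := by
    rw [frobenius_norm_def, ← Real.sqrt_eq_rpow, Real.sq_sqrt (by positivity)]
    simp only [Real.rpow_two]
  rw [h, Finset.sum_comm]
  simp [trace, mul_apply, Complex.conj_mul']

open scoped MatrixOrder in
theorem isCompact_setOf_posSemidef_trace_eq_one [DecidableEq n] :
    IsCompact {ρ : Matrix n n ℂ | ρ.PosSemidef ∧ ρ.trace = 1} := by
  have : ProperSpace (Matrix n n ℂ) := FiniteDimensional.proper ℂ _
  have himage : {ρ : Matrix n n ℂ | ρ.PosSemidef ∧ ρ.trace = 1} =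
      (fun B : Matrix n n ℂ => Bᴴ * B) '' Metric.sphere 0 1 := by
    have hnorm (B : Matrix n n ℂ) : (Bᴴ * B).trace = 1 ↔ ‖B‖ = 1 := by
      rw [trace_conjTranspose_mul_self_eq_frobenius_norm_sq, Complex.ofReal_eq_one,
        pow_eq_one_iff_of_nonneg (norm_nonneg B) two_ne_zero]
    ext ρ
    simp only [Set.mem_ofPred_eq, Set.mem_image, mem_sphere_zero_iff_norm]
    constructor
    · rintro ⟨hρ, htr⟩
      obtain ⟨B, rfl⟩ := CStarAlgebra.nonneg_iff_eq_star_mul_self.1 hρ.nonneg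
      exact ⟨B, (hnorm B).1 htr, rfl⟩
    · rintro ⟨B, hB, rfl⟩
      exact ⟨posSemidef_conjTranspose_mul_self B, (hnorm B).2 hB⟩
  rw [himage]
  refine (isCompact_sphere _ _).image ?_
  exact continuous_id.matrix_conjTranspose.matrix_mul continuous_id

/-- A linear map preserving density matrices fixes one of them. -/
theorem exists_posSemidef_trace_eq_one_fixedPoint [DecidableEq n] [Nonempty n]
    (Φ : Matrix n n ℂ →ₗ[ℂ] Matrix n n ℂ) (hpos : ∀ ρ, ρ.PosSemidef → (Φ ρ).PosSemidef)
    (htr : ∀ ρ, (Φ ρ).trace = ρ.trace) :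
    ∃ ρ : Matrix n n ℂ, ρ.PosSemidef ∧ ρ.trace = 1 ∧ Φ ρ = ρ := by
  obtain ⟨i⟩ := ‹Nonempty n›
  obtain ⟨ρ, ⟨hρ, hρt⟩, hfix⟩ :=
    (LinearMap.toContinuousLinearMap (Φ.restrictScalars ℝ)).exists_fixedPoint_of_isCompact_convex
      isCompact_setOf_posSemidef_trace_eq_one convex_setOf_posSemidef_trace_eq_one
      ⟨vecMulVec (Pi.single i 1) (star (Pi.single i 1)),
        posSemidef_vecMulVec_self_star _, by simp [trace_vecMulVec]⟩
      (fun ρ hρ => ⟨hpos ρ hρ.1, (htr ρ).trans hρ.2⟩)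
  exact ⟨ρ, hρ, hρt, hfix⟩

end DensityMatrices

section PartialTrace

variable {m n : Type*} [Fintype m]

/-- The partial trace over the second tensor factor. -/
def partialTraceRight : Matrix (n × m) (n × m) ℂ →ₗ[ℂ] Matrix n n ℂ where
  toFun M := ∑ j, M.submatrix (·, j) (·, j)
  map_add' M N := by simp [submatrix_add, Finset.sum_add_distrib]
  map_smul' c M := by simp [submatrix_smul, Finset.smul_sum]

theorem partialTraceRight_apply (M : Matrix (n × m) (n × m) ℂ) (i i' : n) :
    partialTraceRight M i i' = ∑ j, M (i, j) (i', j) :=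
  sum_apply i i' Finset.univ fun j => M.submatrix (·, j) (·, j)

theorem PosSemidef.partialTraceRight {M : Matrix (n × m) (n × m) ℂ} (hM : M.PosSemidef) :
    (partialTraceRight M).PosSemidef :=
  posSemidef_sum _ fun _ _ => hM.submatrix _

theorem trace_partialTraceRight [Fintype n] (M : Matrix (n × m) (n × m) ℂ) :
    (partialTraceRight M).trace = M.trace := by
  simp only [trace, diag_apply, partialTraceRight_apply, Fintype.sum_prod_type]

end PartialTrace

end Matrix

/-- Deutsch's self-consistency condition for a closed timelike curve has a solution:
for every unitary interaction `U` on `ℂⁿ ⊗ ℂⁿ` and every unit vector `ψ`, there is a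
density matrix `ρ` with `Tr₂[U (|ψ⟩⟨ψ| ⊗ ρ) U†] = ρ`. -/
theorem deutsch_fixed_point
    {n : Type*} [Fintype n] [DecidableEq n] [Nonempty n]
    (U : Matrix.unitaryGroup (n × n) ℂ)
    (ψ : n → ℂ) (hψ : ∑ i : n, ‖ψ i‖ ^ 2 = 1)
    (P : Matrix n n ℂ) (hP : P = Matrix.vecMulVec ψ (star ψ)) :
    ∃ ρ : Matrix n n ℂ, ρ.PosSemidef ∧ ρ.trace = 1 ∧
      ∀ i i' : n,
        (∑ j : n,
          ((U : Matrix (n × n) (n × n) ℂ) * (P ⊗ₖ ρ) *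
            ((U : Matrix (n × n) (n × n) ℂ).conjTranspose)) (i, j) (i', j)) = ρ i i' := by
  have hPpos : P.PosSemidef := hP ▸ Matrix.posSemidef_vecMulVec_self_star ψ
  have hPtr : P.trace = 1 := by
    rw [hP, Matrix.trace_vecMulVec, dotProduct]
    simp only [Pi.star_apply, RCLike.star_def, Complex.mul_conj']
    exact_mod_cast hψ
  let Ad : Matrix n n ℂ →ₗ[ℂ] Matrix (n × n) (n × n) ℂ :=
    { toFun := fun ρ => (U : Matrix (n × n) (n × n) ℂ) * (P ⊗ₖ ρ) *
        (U : Matrix (n × n) (n × n) ℂ).conjTranspose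
      map_add' := fun ρ σ => by rw [Matrix.kronecker_add, mul_add, add_mul]
      map_smul' := fun c ρ => by
        rw [Matrix.kronecker_smul, mul_smul_comm, smul_mul_assoc, RingHom.id_apply] }
  obtain ⟨ρ, hρ, hρt, hfix⟩ := Matrix.exists_posSemidef_trace_eq_one_fixedPoint
    (Matrix.partialTraceRight ∘ₗ Ad)
    (fun ρ hρ => ((hPpos.kronecker hρ).mul_mul_conjTranspose_same _).partialTraceRight)
    (fun ρ => by
      have hU : (U : Matrix (n × n) (n × n) ℂ)ᴴ * U = 1 := Unitary.coe_star_mul_self U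
      rw [LinearMap.comp_apply, Matrix.trace_partialTraceRight]
      change ((U : Matrix (n × n) (n × n) ℂ) * (P ⊗ₖ ρ) *
        (U : Matrix (n × n) (n × n) ℂ)ᴴ).trace = _
      rw [Matrix.trace_mul_comm, ← mul_assoc, hU, one_mul, Matrix.trace_kronecker, hPtr, one_mul])
  refine ⟨ρ, hρ, hρt, fun i i' => ?_⟩
  rw [← Matrix.partialTraceRight_apply]
  exact congrFun (congrFun hfix i) i'
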